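/- arXiv:2205.09213 — 5 statements merged into one kernel-verified Lean document; each statement's English description precedes it below -/
import Mathlib

section
/- Let a, d ∈ ℝ^N_+ and let B ∈ ℝ^{N×N} be symmetric with all entries positive, B̲ := min_{i,j} B_{ij} > 0, and let λ > 0 be such that λI - B is positive semidefinite. For ε > 0 let Ω_ε := {f ∈ ℝ^N_+ : ‖f‖_∞ ≤ (λ^{-1} + B̲^{-1})‖a‖_∞ + ε} and M_ε := max_{f ∈ closure(Ω_ε)} ‖a - Bf‖_∞. If 0 < τ < 1/(‖d‖_∞ M_ε) and f^0 ∈ Ω_ε, then the sequence {f^n} generated by the discrete-time Lotka-Volterra scheme f^{n+1}_i = f^n_i·(1 + τλd_i f^n_i + τd_i(a - Bf^n)_i)/(1 + τλd_i f^n_i) converges: lim_{n→∞} f^n exists. -/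
open Filter Topology

noncomputable def LVphi (d τ l ft gt x : ℝ) : ℝ :=
  (x - ft - ft * Real.log (x / ft)) / d + (if gt < 0 then 4 else 0) * x / d
    + l * τ / 2 * (x - ft) ^ 2

noncomputable def LVE {N : ℕ} (a : Fin N → ℝ) (B : Matrix (Fin N) (Fin N) ℝ) (f : Fin N → ℝ) : ℝ :=
  1 / 2 * (f ⬝ᵥ B.mulVec f) - a ⬝ᵥ f

lemma LVphi_lower {d τ l ft gt x : ℝ} (hd : 0 < d) (hft : 0 ≤ ft) (hx : 0 < x) :
    l * τ / 2 * (x - ft) ^ 2 ≤ LVphi d τ l ft gt x := by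
  unfold LVphi
  have h1 : 0 ≤ x - ft - ft * Real.log (x / ft) := by
    rcases hft.eq_or_lt with h | h
    · rw [← h]; simp; exact hx.le
    · have := Real.log_le_sub_one_of_pos (div_pos hx h)
      have h2 := mul_le_mul_of_nonneg_left this h.le
      have h3 : ft * (x / ft - 1) = x - ft := by field_simp
      linarith
  have h2 : 0 ≤ (if gt < 0 then (4:ℝ) else 0) * x / d := by
    split_ifs
    · positivity
    · simp
  have h3 := div_nonneg h1 hd.le
  linarith

lemma LVphi_zero {d τ l ft gt : ℝ} (hg : ft * gt = 0) :
    LVphi d τ l ft gt ft = 0 := by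
  unfold LVphi
  by_cases h : ft = 0
  · simp [h]
  · have : gt = 0 := by simpa [h] using hg
    simp [this, h]

lemma LVphi_cont {d τ l ft gt : ℝ} : ContinuousAt (LVphi d τ l ft gt) ft := by
  unfold LVphi
  by_cases h : ft = 0
  · subst h
    simp only [zero_mul]
    fun_prop
  · have : ContinuousAt (fun x => Real.log (x / ft)) ft := by
      apply ContinuousAt.log
      · fun_prop
      · simp [h]
    fun_prop

lemma LVphi_step {d τ l ft gt f p g κ : ℝ} (hd : 0 < d) (hτ : 0 < τ) (hl : 0 < l) (hκ : 0 < κ)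
    (hft : 0 ≤ ft) (hf : 0 < f) (hp : κ * f ≤ p)
    (hs : p - f = τ * d * f * (g - l * (p - f)))
    (hg : ft * gt = 0) (h1 : ft / 2 < f) (h2 : gt < 0 → g < gt / 2 ∧ τ * l * d * f < 1) :
    LVphi d τ l ft gt p - LVphi d τ l ft gt f ≤
      τ * ((g + gt) * (f - ft)) + (4 / (d * κ * ft) + l * τ / 2) * (p - f) ^ 2 := by
  have hp0 : 0 < p := lt_of_lt_of_le (by positivity) hp
  have key1 : (p - ft - ft * Real.log (p / ft)) / d - (f - ft - ft * Real.log (f / ft)) / d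
      ≤ τ * (g - l * (p - f)) * (f - ft) + 4 / (d * κ * ft) * (p - f) ^ 2 := by
    have e1 : (p - f) / d = τ * f * (g - l * (p - f)) := by
      rw [div_eq_iff hd.ne']; linarith
    rcases hft.eq_or_lt with h | h
    · rw [← h]; simp
      rw [sub_div] at e1; linarith
    · have hlog : Real.log (p / ft) - Real.log (f / ft) = Real.log (p / f) := by
        rw [Real.log_div hp0.ne' h.ne', Real.log_div hf.ne' h.ne', Real.log_div hp0.ne' hf.ne']
        ring
      have hl2 : 1 - f / p ≤ Real.log (p / f) := by
        have := Real.one_sub_inv_le_log_of_pos (div_pos hp0 hf)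
        rwa [inv_div] at this
      have e2 : (p - ft - ft * Real.log (p / ft)) / d - (f - ft - ft * Real.log (f / ft)) / d
        = (p - f) / d - ft / d * Real.log (p / f) := by
        rw [← hlog]; ring
      have e3 : ft / d * (1 - f / p) ≤ ft / d * Real.log (p / f) :=
        mul_le_mul_of_nonneg_left hl2 (by positivity)
      have e4 : ft / d * (1 - f / p) = ft / f * ((p - f) / d) - ft / d * (p - f) ^ 2 / (f * p) := by
        field_simp; ring
      have e5 : ft / f * ((p - f) / d) = τ * ft * (g - l * (p - f)) := by
        rw [e1]; field_simp
      have e6 : ft / d * (p - f) ^ 2 / (f * p) ≤ 4 / (d * κ * ft) * (p - f) ^ 2 := by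
        have : ft / d / (f * p) ≤ 4 / (d * κ * ft) := by
          rw [div_div, div_le_div_iff₀ (by positivity) (by positivity)]
          have : κ * (ft * ft) ≤ 4 * (f * p) := by
            have : f * (κ * f) ≤ f * p := mul_le_mul_of_nonneg_left hp hf.le
            have : ft * ft ≤ 4 * (f * f) := by nlinarith
            nlinarith
          nlinarith
        calc _ = ft / d / (f * p) * (p - f) ^ 2 := by ring
          _ ≤ _ := mul_le_mul_of_nonneg_right this (sq_nonneg _)
      rw [e2]
      have e7 : (p - f) / d - τ * ft * (g - l * (p - f)) = τ * (g - l * (p - f)) * (f - ft) := by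
        rw [e1]; ring
      linarith
  have key2 : (if gt < 0 then (4:ℝ) else 0) * p / d - (if gt < 0 then (4:ℝ) else 0) * f / d
      ≤ τ * (gt * (f - ft)) := by
    split_ifs with h
    · obtain ⟨h3, h4⟩ := h2 h
      have hft0 : ft = 0 := by simpa [h.ne] using hg
      subst hft0
      have : p - f = τ * d * f * g / (1 + τ * l * d * f) := by
        rw [eq_div_iff (by positivity)]; linarith
      have e : 4 * p / d - 4 * f / d = 4 * τ * f * g / (1 + τ * l * d * f) := by
        rw [← sub_div, ← mul_sub, this]; field_simp
      rw [e, div_le_iff₀ (by positivity), sub_zero]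
      have hq : 0 ≤ τ * f := by positivity
      have : 4 * g ≤ gt * (1 + τ * l * d * f) := by nlinarith
      nlinarith
    · push Not at h
      have : ft * gt = 0 := hg
      simp only [zero_mul, zero_div, sub_zero]
      have : gt * (f - ft) = gt * f := by linarith
      rw [this]; positivity
  have key3 : l * τ / 2 * (p - ft) ^ 2 - l * τ / 2 * (f - ft) ^ 2
     = τ * l * (p - f) * (f - ft) + l * τ / 2 * (p - f) ^ 2 := by ring
  unfold LVphi
  linarith

lemma LVE_diff {N : ℕ} (a : Fin N → ℝ) (B : Matrix (Fin N) (Fin N) ℝ) (hB : B.IsSymm)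
    (f p : Fin N → ℝ) : LVE a B p - LVE a B f =
      - ((a - B.mulVec f) ⬝ᵥ (p - f)) + 1 / 2 * ((p - f) ⬝ᵥ B.mulVec (p - f)) := by
  have h : f ⬝ᵥ B.mulVec p = p ⬝ᵥ B.mulVec f := by
    rw [Matrix.dotProduct_mulVec, ← Matrix.mulVec_transpose, hB.eq, dotProduct_comm]
  have h2 := dotProduct_comm (B.mulVec f) p
  have h3 := dotProduct_comm (B.mulVec f) f
  unfold LVE
  simp only [Matrix.mulVec_sub, dotProduct_sub, sub_dotProduct, h, h2, h3]
  ring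

lemma LVE_dec {N : ℕ} (a : Fin N → ℝ) (B : Matrix (Fin N) (Fin N) ℝ) (hB : B.IsSymm) {l : ℝ}
    (hpsd : (l • (1 : Matrix (Fin N) (Fin N) ℝ) - B).PosSemidef) (hl : 0 < l)
    (d : Fin N → ℝ) (hd : ∀ i, 0 < d i) {τ : ℝ} (hτ : 0 < τ)
    (f p : Fin N → ℝ) (hf : ∀ i, 0 < f i)
    (hs : ∀ i, p i - f i = τ * d i * f i * (a i - B.mulVec f i - l * (p i - f i))) :
    LVE a B p - LVE a B f ≤ - (l / 2 * ∑ i, (p i - f i) ^ 2) := by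
  rw [LVE_diff a B hB]
  have h1 := hpsd.dotProduct_mulVec_nonneg (p - f)
  simp only [star_trivial, Matrix.sub_mulVec, Matrix.smul_mulVec, Matrix.one_mulVec,
    dotProduct_sub, dotProduct_smul, smul_eq_mul] at h1
  have h2 : (p - f) ⬝ᵥ (p - f) = ∑ i, (p i - f i) ^ 2 := by
    simp [dotProduct, sq]
  have h3 : l * ∑ i, (p i - f i) ^ 2 ≤ (a - B.mulVec f) ⬝ᵥ (p - f) := by
    rw [Finset.mul_sum]
    unfold dotProduct
    apply Finset.sum_le_sum
    intro i _
    simp only [Pi.sub_apply]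
    have := hs i
    set δ := p i - f i
    set g := a i - B.mulVec f i
    have hq : 0 < τ * d i * f i := by have := hd i; have := hf i; positivity
    have : 0 ≤ (τ * d i * f i) * ((g - l * δ) * δ) := by
      rw [← mul_assoc, ← this]; exact mul_self_nonneg _
    have := nonneg_of_mul_nonneg_right this hq
    linarith
  have h4 : (p - f) ⬝ᵥ (p - f) = (p ⬝ᵥ p - f ⬝ᵥ p) - (p ⬝ᵥ f - f ⬝ᵥ f) := by
    simp [dotProduct_sub, sub_dotProduct]
  simp only [dotProduct_sub, sub_dotProduct, Matrix.mulVec_sub] at *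
  rw [h2] at h1
  linarith

lemma LV_step {N : ℕ} (a : Fin N → ℝ) (B : Matrix (Fin N) (Fin N) ℝ) (hB : B.IsSymm) {l κ : ℝ}
    (hl : 0 < l) (hκ : 0 < κ)
    (d : Fin N → ℝ) (hd : ∀ i, 0 < d i) {τ : ℝ} (hτ : 0 < τ)
    (f p ft : Fin N → ℝ) (hf : ∀ i, 0 < f i) (hft : ∀ i, 0 ≤ ft i)
    (hs : ∀ i, p i - f i = τ * d i * f i * (a i - B.mulVec f i - l * (p i - f i)))
    (hp : ∀ i, κ * f i ≤ p i)
    (hg : ∀ i, ft i * (a i - B.mulVec ft i) = 0)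
    (hE : LVE a B ft ≤ LVE a B f)
    (hdec : LVE a B p - LVE a B f ≤ - (l / 2 * ∑ i, (p i - f i) ^ 2))
    (h1 : ∀ i, ft i / 2 < f i)
    (h2 : ∀ i, a i - B.mulVec ft i < 0 →
      a i - B.mulVec f i < (a i - B.mulVec ft i) / 2 ∧ τ * l * d i * f i < 1) :
    ∑ i, LVphi (d i) τ l (ft i) (a i - B.mulVec ft i) (p i)
      + (2 / l * ∑ i, 4 / (d i * κ * ft i) + τ) * (LVE a B p - LVE a B ft) ≤
    ∑ i, LVphi (d i) τ l (ft i) (a i - B.mulVec ft i) (f i)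
      + (2 / l * ∑ i, 4 / (d i * κ * ft i) + τ) * (LVE a B f - LVE a B ft) := by
  have hK : ∀ i, 0 ≤ 4 / (d i * κ * ft i) := fun i => by
    have := hd i; have := hft i; positivity
  set K := ∑ i, 4 / (d i * κ * ft i) with hKdef
  have hK0 : 0 ≤ K := Finset.sum_nonneg fun i _ => hK i
  have hsum : ∑ i, (LVphi (d i) τ l (ft i) (a i - B.mulVec ft i) (p i) -
      LVphi (d i) τ l (ft i) (a i - B.mulVec ft i) (f i)) ≤
      ∑ i, (τ * (((a i - B.mulVec f i) + (a i - B.mulVec ft i)) * (f i - ft i))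
        + (K + l * τ / 2) * (p i - f i) ^ 2) := by
    apply Finset.sum_le_sum
    intro i _
    refine (LVphi_step (hd i) hτ hl hκ (hft i) (hf i) (hp i) (hs i) (hg i) (h1 i) (h2 i)).trans ?_
    have : 4 / (d i * κ * ft i) ≤ K :=
      Finset.single_le_sum (f := fun i => 4 / (d i * κ * ft i)) (fun i _ => hK i) (Finset.mem_univ i)
    gcongr
  rw [Finset.sum_sub_distrib, Finset.sum_add_distrib, ← Finset.mul_sum, ← Finset.mul_sum] at hsum
  have hid : ∑ i, ((a i - B.mulVec f i) + (a i - B.mulVec ft i)) * (f i - ft i)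
      = - 2 * (LVE a B f - LVE a B ft) := by
    have e1 := LVE_diff a B hB ft f
    have e2 := LVE_diff a B hB f ft
    have e3 : (ft - f) ⬝ᵥ B.mulVec (ft - f) = (f - ft) ⬝ᵥ B.mulVec (f - ft) := by
      rw [← neg_sub f ft]; simp only [Matrix.mulVec_neg, dotProduct_neg, neg_dotProduct, neg_neg]
    have e4 : (a - B.mulVec f) ⬝ᵥ (ft - f) = - ((a - B.mulVec f) ⬝ᵥ (f - ft)) := by
      rw [← neg_sub f ft]; simp only [dotProduct_neg]
    have e5 : ∑ i, ((a i - B.mulVec f i) + (a i - B.mulVec ft i)) * (f i - ft i)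
      = (a - B.mulVec f) ⬝ᵥ (f - ft) + (a - B.mulVec ft) ⬝ᵥ (f - ft) := by
      simp [dotProduct, add_mul, Finset.sum_add_distrib]
    rw [e3, e4] at e2
    rw [e5]
    linarith
  rw [hid] at hsum
  have h5 : (2 / l * K + τ) * (LVE a B p - LVE a B f) ≤
      (2 / l * K + τ) * (- (l / 2 * ∑ i, (p i - f i) ^ 2)) :=
    mul_le_mul_of_nonneg_left hdec (by positivity)
  have h6 : (2 / l * K + τ) * (- (l / 2 * ∑ i, (p i - f i) ^ 2)) =
     - ((K + l * τ / 2) * ∑ i, (p i - f i) ^ 2) := by field_simp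
  have h7 : 0 ≤ τ * (LVE a B f - LVE a B ft) := mul_nonneg hτ.le (by linarith)
  linarith

lemma LVE_cont {N : ℕ} (a : Fin N → ℝ) (B : Matrix (Fin N) (Fin N) ℝ) : Continuous (LVE a B) := by
  unfold LVE Matrix.mulVec dotProduct
  fun_prop


/-- Convergence of the discrete-time competitive Lotka–Volterra
scheme: for `B` symmetric with positive entries, `λI - B` positive semidefinite,
initial data in `Ω_ε`, and step `0 < τ < 1/(‖d‖_∞ M_ε)`, the iterates converge. -/
theorem discrete_lotka_volterra_convergence {N : ℕ}
    (a d : Fin N → ℝ) (ha : ∀ i, 0 < a i) (hd : ∀ i, 0 < d i)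
    (B : Matrix (Fin N) (Fin N) ℝ) (hB : B.IsSymm) (hBpos : ∀ i j, 0 < B i j)
    (Bmin : ℝ) (hBmin : IsLeast {x | ∃ i j, B i j = x} Bmin) (hBminpos : 0 < Bmin)
    (lam : ℝ) (hlam : 0 < lam)
    (hpsd : (lam • (1 : Matrix (Fin N) (Fin N) ℝ) - B).PosSemidef)
    (ε : ℝ) (hε : 0 < ε)
    (Ω : Set (Fin N → ℝ))
    (hΩ : Ω = {f | (∀ i, 0 < f i) ∧ ‖f‖ ≤ (lam⁻¹ + Bmin⁻¹) * ‖a‖ + ε})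
    (M : ℝ) (hM : IsGreatest ((fun f => ‖a - B.mulVec f‖) '' closure Ω) M)
    (τ : ℝ) (hτ : 0 < τ) (hτM : τ < 1 / (‖d‖ * M))
    (f : ℕ → Fin N → ℝ) (hf0 : f 0 ∈ Ω)
    (hstep : ∀ n i, f (n+1) i
      = f n i * (1 + τ * lam * d i * f n i + τ * d i * (a i - B.mulVec (f n) i))
        / (1 + τ * lam * d i * f n i)) :
    ∃ ftil : Fin N → ℝ, Tendsto f atTop (𝓝 ftil) := by
  have hdM : 0 < ‖d‖ * M := by
    have : 0 < 1 / (‖d‖ * M) := hτ.trans hτM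
    exact one_div_pos.mp this
  have hκ : 0 < 1 - τ * (‖d‖ * M) := by
    rw [lt_div_iff₀ hdM] at hτM; linarith
  obtain ⟨κ, hκe⟩ : ∃ κ, κ = 1 - τ * (‖d‖ * M) := ⟨_, rfl⟩
  rw [← hκe] at hκ
  have hai : ∀ i, a i ≤ ‖a‖ := fun i => (le_abs_self _).trans (norm_le_pi_norm a i)
  have hdi : ∀ i, d i ≤ ‖d‖ := fun i => (le_abs_self _).trans (norm_le_pi_norm d i)
  -- lower bound from Ω
  have hlow : ∀ n, f n ∈ Ω → ∀ i, κ * f n i ≤ f (n+1) i := by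
    intro n hn i
    have hpos : 0 < f n i := by rw [hΩ] at hn; exact hn.1 i
    have hgM : ‖a - B.mulVec (f n)‖ ≤ M := hM.2 ⟨f n, subset_closure hn, rfl⟩
    have hgi : |a i - B.mulVec (f n) i| ≤ M := (norm_le_pi_norm (a - B.mulVec (f n)) i).trans hgM
    have hd' := hd i
    have h1 : 0 < τ * lam * d i * f n i := by positivity
    rw [hstep, le_div_iff₀ (by positivity)]
    have h2 : d i * |a i - B.mulVec (f n) i| ≤ ‖d‖ * M :=
      mul_le_mul (hdi i) hgi (abs_nonneg _) (norm_nonneg _)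
    have h3 : - (d i * |a i - B.mulVec (f n) i|) ≤ d i * (a i - B.mulVec (f n) i) := by
      have := neg_abs_le (a i - B.mulVec (f n) i)
      nlinarith
    have h4 : κ * (1 + τ * lam * d i * f n i) ≤
        1 + τ * lam * d i * f n i + τ * d i * (a i - B.mulVec (f n) i) := by
      have h5 : τ * (-(‖d‖ * M)) ≤ τ * (d i * (a i - B.mulVec (f n) i)) :=
        mul_le_mul_of_nonneg_left (by linarith) hτ.le
      have h6 : κ ≤ 1 := by rw [hκe]; nlinarith
      nlinarith
    nlinarith
  have hinv : ∀ n, f n ∈ Ω := by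
    intro n
    induction n with
    | zero => exact hf0
    | succ n ih =>
      have hl := hlow n ih
      have ih' := ih
      rw [hΩ] at ih ⊢
      obtain ⟨hpos, hnorm⟩ := ih
      have hp : ∀ i, 0 < f (n+1) i := fun i => lt_of_lt_of_le (mul_pos hκ (hpos i)) (hl i)
      refine ⟨hp, ?_⟩
      have hR : 0 ≤ (lam⁻¹ + Bmin⁻¹) * ‖a‖ + ε := by positivity
      rw [pi_norm_le_iff_of_nonneg hR]
      intro i
      rw [Real.norm_eq_abs, abs_of_pos (hp i)]
      have hd' := hd i
      have hfi := hpos i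
      have h1 : 0 < τ * lam * d i * f n i := by positivity
      have hBf : Bmin * f n i ≤ B.mulVec (f n) i := by
        have h2 : B i i * f n i ≤ ∑ j, B i j * f n j :=
          Finset.single_le_sum (f := fun j => B i j * f n j)
            (fun j _ => (mul_pos (hBpos i j) (hpos j)).le) (Finset.mem_univ i)
        have h3 : Bmin ≤ B i i := hBmin.2 ⟨i, i, rfl⟩
        have h4 : B.mulVec (f n) i = ∑ j, B i j * f n j := rfl
        rw [h4]; nlinarith
      by_cases hc : ‖a‖ ≤ Bmin * f n i
      · have h2 : f (n+1) i ≤ f n i := by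
          rw [hstep, div_le_iff₀ (by positivity)]
          have : a i - B.mulVec (f n) i ≤ 0 := by linarith [hai i]
          have : f n i * (τ * d i * (a i - B.mulVec (f n) i)) ≤ 0 :=
            mul_nonpos_of_nonneg_of_nonpos hfi.le
              (mul_nonpos_of_nonneg_of_nonpos (by positivity) this)
          nlinarith
        have h3 : f n i ≤ ‖f n‖ := (le_abs_self _).trans (norm_le_pi_norm (f n) i)
        linarith
      · push Not at hc
        have h2 : f n i ≤ Bmin⁻¹ * ‖a‖ := by
          rw [inv_mul_eq_div, le_div_iff₀ hBminpos]; linarith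
        have h3 : f (n+1) i ≤ f n i + lam⁻¹ * ‖a‖ := by
          rw [hstep, div_le_iff₀ (by positivity)]
          have h4 : a i - B.mulVec (f n) i ≤ ‖a‖ := by
            have : 0 < Bmin * f n i := by positivity
            linarith [hai i]
          have h5 : f n i * (τ * d i * (a i - B.mulVec (f n) i)) ≤ f n i * (τ * d i * ‖a‖) := by
            gcongr
          have h6 : lam⁻¹ * ‖a‖ * (τ * lam * d i * f n i) = f n i * (τ * d i * ‖a‖) := by
            field_simp
          have h7 : 0 ≤ lam⁻¹ * ‖a‖ := by positivity
          nlinarith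
        linarith
  have hpos : ∀ n i, 0 < f n i := by
    intro n i
    have := hinv n
    rw [hΩ] at this
    exact this.1 i
  have hs : ∀ n i, f (n+1) i - f n i =
      τ * d i * f n i * (a i - B.mulVec (f n) i - lam * (f (n+1) i - f n i)) := by
    intro n i
    have := hd i
    have := hpos n i
    have h1 : 0 < τ * lam * d i * f n i := by positivity
    have h2 : f (n+1) i * (1 + τ * lam * d i * f n i) =
      f n i * (1 + τ * lam * d i * f n i + τ * d i * (a i - B.mulVec (f n) i)) := by
      rw [hstep, div_mul_cancel₀ _ (by positivity)]
    linarith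
  have hdec := fun n => LVE_dec a B hB hpsd hlam d hd hτ (f n) (f (n+1)) (hpos n) (hs n)
  have hanti : Antitone fun n => LVE a B (f n) := by
    apply antitone_nat_of_succ_le
    intro n
    have := hdec n
    have : 0 ≤ lam / 2 * ∑ i, (f (n+1) i - f n i) ^ 2 := by positivity
    linarith
  have hbdd : ∀ n, f n ∈ Metric.closedBall (0 : Fin N → ℝ) ((lam⁻¹ + Bmin⁻¹) * ‖a‖ + ε) := by
    intro n
    have := hinv n
    rw [hΩ] at this
    simpa using this.2
  obtain ⟨ft, -, φ, hφ, hlim⟩ := (isCompact_closedBall _ _).tendsto_subseq hbdd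
  have hlimi : ∀ i, Tendsto (fun k => f (φ k) i) atTop (𝓝 (ft i)) := fun i =>
    (tendsto_pi_nhds.mp hlim) i
  have hft : ∀ i, 0 ≤ ft i := fun i => ge_of_tendsto' (hlimi i) fun k => (hpos _ i).le
  have hElim : Tendsto (fun n => LVE a B (f n)) atTop (𝓝 (LVE a B ft)) := by
    rw [tendsto_iff_tendsto_subseq_of_antitone hanti hφ.tendsto_atTop]
    exact ((LVE_cont a B).tendsto ft).comp hlim
  have hEge : ∀ n, LVE a B ft ≤ LVE a B (f n) := hanti.le_of_tendsto hElim
  have hgc : ∀ i, Continuous fun x : Fin N → ℝ => a i - B.mulVec x i := by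
    intro i
    unfold Matrix.mulVec dotProduct
    fun_prop
  have hδ : ∀ i, Tendsto (fun n => f (n+1) i - f n i) atTop (𝓝 0) := by
    intro i
    have h0 : Tendsto (fun n => 2 / lam * (LVE a B (f n) - LVE a B (f (n+1)))) atTop (𝓝 0) := by
      have := (hElim.sub (hElim.comp (tendsto_add_atTop_nat 1))).const_mul (2 / lam)
      simpa using this
    have h1 : Tendsto (fun n => (f (n+1) i - f n i) ^ 2) atTop (𝓝 0) := by
      refine squeeze_zero (fun n => sq_nonneg _) (fun n => ?_) h0
      have h2 : (f (n+1) i - f n i) ^ 2 ≤ ∑ i, (f (n+1) i - f n i) ^ 2 :=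
        Finset.single_le_sum (f := fun i => (f (n+1) i - f n i) ^ 2)
          (fun _ _ => sq_nonneg _) (Finset.mem_univ i)
      have h3 := hdec n
      refine h2.trans ?_
      rw [div_mul_eq_mul_div, le_div_iff₀ hlam]
      linarith
    have h2 := h1.sqrt
    simp only [Real.sqrt_sq_eq_abs, Real.sqrt_zero] at h2
    exact (tendsto_zero_iff_abs_tendsto_zero _).mpr h2
  have hg : ∀ i, ft i * (a i - B.mulVec ft i) = 0 := by
    intro i
    have h1 := (hδ i).comp hφ.tendsto_atTop
    have h2 : Tendsto (fun k => τ * d i * f (φ k) i *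
        (a i - B.mulVec (f (φ k)) i - lam * (f (φ k+1) i - f (φ k) i))) atTop
        (𝓝 (τ * d i * ft i * ((a i - B.mulVec ft i) - lam * 0))) :=
      ((hlimi i).const_mul (τ * d i)).mul ((((hgc i).tendsto ft).comp hlim).sub (h1.const_mul lam))
    have h3 := tendsto_nhds_unique h2 (h1.congr fun k => hs (φ k) i)
    have hd' := hd i
    have h4 : τ * d i ≠ 0 := by positivity
    rw [mul_zero, sub_zero, mul_assoc] at h3
    exact (mul_eq_zero.mp h3).resolve_left h4
  -- neighbourhood
  have hnear : ∀ᶠ x in 𝓝 ft, ∀ i, (0 < x i → ft i / 2 < x i) ∧ (a i - B.mulVec ft i < 0 →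
      a i - B.mulVec x i < (a i - B.mulVec ft i) / 2 ∧ τ * lam * d i * x i < 1) := by
    rw [eventually_all]
    intro i
    apply Filter.Eventually.and
    · rcases (hft i).eq_or_lt with h | h
      · filter_upwards with x hx
        rw [← h]; simpa using hx
      · have : ∀ᶠ x : Fin N → ℝ in 𝓝 ft, ft i / 2 < x i :=
          (continuous_apply i).continuousAt.eventually (lt_mem_nhds (by linarith))
        filter_upwards [this] with x hx _ using hx
    · by_cases h : a i - B.mulVec ft i < 0
      · have h0 : ft i = 0 := (mul_eq_zero.mp (hg i)).resolve_right h.ne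
        have e1 : ∀ᶠ x : Fin N → ℝ in 𝓝 ft, a i - B.mulVec x i < (a i - B.mulVec ft i) / 2 :=
          (hgc i).continuousAt.eventually (gt_mem_nhds (by linarith))
        have c2 : Continuous fun x : Fin N → ℝ => τ * lam * d i * x i := by fun_prop
        have e2 : ∀ᶠ x : Fin N → ℝ in 𝓝 ft, τ * lam * d i * x i < 1 :=
          c2.continuousAt.eventually (gt_mem_nhds (by simp [h0]))
        filter_upwards [e1, e2] with x h1 h2 _ using ⟨h1, h2⟩
      · exact Eventually.of_forall fun x hx => absurd hx h
  obtain ⟨r0, hr0, hball⟩ := Metric.eventually_nhds_iff.mp hnear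
  obtain ⟨K, hK⟩ : ∃ K, K = 2 / lam * ∑ i, 4 / (d i * κ * ft i) + τ := ⟨_, rfl⟩
  have hK0 : 0 ≤ K := by
    rw [hK]
    have : 0 ≤ ∑ i, 4 / (d i * κ * ft i) := Finset.sum_nonneg fun i _ => by
      have := hd i; have := hft i; positivity
    positivity
  let L : (Fin N → ℝ) → ℝ := fun x =>
    ∑ i, LVphi (d i) τ lam (ft i) (a i - B.mulVec ft i) (x i) + K * (LVE a B x - LVE a B ft)
  have hLstep : ∀ n, dist (f n) ft < r0 → L (f (n+1)) ≤ L (f n) := by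
    intro n hn
    have hb := hball hn
    have := LV_step a B hB hlam hκ d hd hτ (f n) (f (n+1)) ft (hpos n) hft (hs n)
      (hlow n (hinv n)) hg (hEge n) (hdec n) (fun i => (hb i).1 (hpos n i)) (fun i => (hb i).2)
    rw [← hK] at this
    exact this
  have hLlow : ∀ n i, lam * τ / 2 * (f n i - ft i) ^ 2 ≤ L (f n) := by
    intro n i
    have hnn : ∀ j, lam * τ / 2 * (f n j - ft j) ^ 2 ≤
        LVphi (d j) τ lam (ft j) (a j - B.mulVec ft j) (f n j) := fun j =>
      LVphi_lower (hd j) (hft j) (hpos n j)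
    have h1 := Finset.single_le_sum
      (f := fun j => LVphi (d j) τ lam (ft j) (a j - B.mulVec ft j) (f n j))
      (fun j _ => le_trans (by positivity) (hnn j)) (Finset.mem_univ i)
    have h2 : 0 ≤ K * (LVE a B (f n) - LVE a B ft) := mul_nonneg hK0 (by linarith [hEge n])
    have h3 := hnn i
    show _ ≤ ∑ i, LVphi (d i) τ lam (ft i) (a i - B.mulVec ft i) (f n i) + _
    linarith
  have hLc : Tendsto (fun k => L (f (φ k))) atTop (𝓝 0) := by
    have h1 : Tendsto (fun k => ∑ i, LVphi (d i) τ lam (ft i) (a i - B.mulVec ft i) (f (φ k) i))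
        atTop (𝓝 (∑ i, LVphi (d i) τ lam (ft i) (a i - B.mulVec ft i) (ft i))) :=
      tendsto_finsetSum _ fun i _ => LVphi_cont.tendsto.comp (hlimi i)
    have h2 : ∑ i, LVphi (d i) τ lam (ft i) (a i - B.mulVec ft i) (ft i) = 0 :=
      Finset.sum_eq_zero fun i _ => LVphi_zero (hg i)
    have h3 := h1.add (((hElim.comp hφ.tendsto_atTop).sub_const (LVE a B ft)).const_mul K)
    rw [h2] at h3
    simpa using h3
  refine ⟨ft, Metric.tendsto_atTop.mpr fun r hr => ?_⟩
  obtain ⟨s, hsdef⟩ : ∃ s, s = min r r0 := ⟨_, rfl⟩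
  have hs0 : 0 < s := by rw [hsdef]; exact lt_min hr hr0
  have hclose : ∀ n, L (f n) < lam * τ / 2 * s ^ 2 → dist (f n) ft < s := by
    intro n hn
    rw [dist_pi_lt_iff hs0]
    intro i
    have h1 := (hLlow n i).trans_lt hn
    have h2 : (f n i - ft i) ^ 2 < s ^ 2 := lt_of_mul_lt_mul_left h1 (by positivity)
    rw [Real.dist_eq]
    exact abs_lt_of_sq_lt_sq h2 hs0.le
  have hc : 0 < lam * τ / 2 * s ^ 2 := by positivity
  obtain ⟨k, hk⟩ := (hLc.eventually (gt_mem_nhds hc)).exists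
  refine ⟨φ k, fun n hn => ?_⟩
  have hall : L (f n) < lam * τ / 2 * s ^ 2 := by
    induction n, hn using Nat.le_induction with
    | base => exact hk
    | succ n _ ih =>
      have : dist (f n) ft < r0 := (hclose n ih).trans_le (by rw [hsdef]; exact min_le_right _ _)
      exact (hLstep n this).trans_lt ih
  exact (hclose n hall).trans_le (by rw [hsdef]; exact min_le_left _ _)
end

section
/- Let a ∈ ℝ^N have nonnegative entries, and let B⁺, B⁻ ∈ ℝ^{N×N} have nonnegative entries with B⁺ positive definite (so in particular B⁺_{ii} > 0 for all i). Suppose {u^n}_{n≥0} ⊂ ℝ^N is a sequence satisfying the implicit DC-algorithm relation for the Lotka-Volterra energy: for all n and all i, u^{n+1}_i·(B⁺[u^{n+1}]²)_i = u^n_i·(a + B⁻[u^n]²)_i, where [v]² denotes the componentwise square. If u^0 has all components nonnegative, then every u^n has all components nonnegative; moreover if a ∈ ℝ^N_+ and u^0 ∈ ℝ^N_+ then u^n ∈ ℝ^N_+ for all n. -/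
/-- Positivity of the implicit DC iteration for the de-singularized
Lotka–Volterra energy: if `uⁿ⁺¹ᵢ(B⁺[uⁿ⁺¹]²)ᵢ = uⁿᵢ(a + B⁻[uⁿ]²)ᵢ` with `a, B⁺, B⁻`
entrywise nonnegative and `B⁺` positive definite, then nonnegativity (resp. strict
positivity, when `a` and `u⁰` are positive) of the iterates is preserved. -/
theorem dc_lotka_volterra_positivity {N : ℕ}
    (a : Fin N → ℝ) (ha : ∀ i, 0 ≤ a i)
    (Bp Bm : Matrix (Fin N) (Fin N) ℝ)
    (hBp : ∀ i j, 0 ≤ Bp i j) (hBm : ∀ i j, 0 ≤ Bm i j)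
    (hBpdef : Bp.PosDef)
    (u : ℕ → Fin N → ℝ)
    (hrel : ∀ n i, u (n+1) i * Bp.mulVec (fun j => (u (n+1) j)^2) i
      = u n i * (a i + Bm.mulVec (fun j => (u n j)^2) i)) :
    ((∀ i, 0 ≤ u 0 i) → ∀ n i, 0 ≤ u n i) ∧
    ((∀ i, 0 < a i) → (∀ i, 0 < u 0 i) → ∀ n i, 0 < u n i) := by
  have hnn : ∀ (M : Matrix (Fin N) (Fin N) ℝ), (∀ i j, 0 ≤ M i j) → ∀ (v : Fin N → ℝ) i,
      0 ≤ M.mulVec (fun j => (v j)^2) i := by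
    intro M hM v i
    simp only [Matrix.mulVec, dotProduct]
    exact Finset.sum_nonneg fun j _ => mul_nonneg (hM i j) (sq_nonneg _)
  constructor
  · intro h0 n
    induction n with
    | zero => exact h0
    | succ n ih =>
      intro i
      by_contra! hneg
      have hd : 0 < Bp i i := hBpdef.diag_pos
      have h1 : Bp i i * (u (n+1) i)^2 ≤ Bp.mulVec (fun j => (u (n+1) j)^2) i :=
        Finset.single_le_sum (f := fun j => Bp i j * (u (n+1) j)^2)
          (fun j _ => mul_nonneg (hBp i j) (sq_nonneg _)) (Finset.mem_univ i)
      have h2 : 0 < Bp i i * (u (n+1) i)^2 := mul_pos hd (sq_pos_of_neg hneg)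
      have h3 := mul_neg_of_neg_of_pos hneg (h2.trans_le h1)
      have h4 := mul_nonneg (ih i) (add_nonneg (ha i) (hnn Bm hBm (u n) i))
      have h5 := hrel n i
      linarith
  · intro hap h0 n
    induction n with
    | zero => exact h0
    | succ n ih =>
      intro i
      have h4 := mul_pos (ih i) (add_pos_of_pos_of_nonneg (hap i) (hnn Bm hBm (u n) i))
      rw [← hrel n i] at h4
      exact pos_of_mul_pos_left h4 (hnn Bp hBp (u (n+1)) i)
end

section
/- Let B ∈ ℝ^{N×N} be symmetric, let λ > 0 satisfy λ ≥ ρ(B) (the spectral radius of B), let β := max(0, max_{i≠j} B_{ij}) be the maximum nonnegative off-diagonal element (or zero), and let 𝟙 ∈ ℝ^N be the all-ones vector. Define B⁺ := λI + β·𝟙𝟙ᵀ and B⁻ := B⁺ - B. Then B⁺ and B⁻ both have nonnegative entries, B⁺ is positive definite, and B⁻ is positive semidefinite. -/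
/-- Convex splitting of a symmetric matrix: with `λ` at least the
spectral radius of `B` (i.e. `|μ| ≤ λ` for every eigenvalue `μ`), `β` the maximum
nonnegative off-diagonal entry (or zero), `B⁺ := λI + β𝟙𝟙ᵀ` and `B⁻ := B⁺ - B`, both
`B⁺` and `B⁻` have nonnegative entries, `B⁺` is positive definite and `B⁻` is
positive semidefinite. -/
theorem convex_splitting_of_symmetric_matrix {N : ℕ}
    (B : Matrix (Fin N) (Fin N) ℝ) (hB : B.IsSymm)
    (lam : ℝ) (hlam : 0 < lam)
    (hspec : ∀ μ : ℝ, Module.End.HasEigenvalue (Matrix.toLin' B) μ → |μ| ≤ lam)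
    (β : ℝ) (hβ : IsGreatest (insert (0:ℝ) {x | ∃ i j, i ≠ j ∧ B i j = x}) β)
    (Bp Bm : Matrix (Fin N) (Fin N) ℝ)
    (hBp : Bp = lam • (1 : Matrix (Fin N) (Fin N) ℝ) + β • Matrix.of (fun _ _ => (1:ℝ)))
    (hBm : Bm = Bp - B) :
    (∀ i j, 0 ≤ Bp i j) ∧ (∀ i j, 0 ≤ Bm i j) ∧ Bp.PosDef ∧ Bm.PosSemidef := by
  have hβ0 : 0 ≤ β := hβ.2 (Set.mem_insert _ _)
  have hoff : ∀ i j, i ≠ j → B i j ≤ β := fun i j h =>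
    hβ.2 (Set.mem_insert_of_mem _ ⟨i, j, h, rfl⟩)
  have hCH : (lam • (1 : Matrix (Fin N) (Fin N) ℝ) - B).IsHermitian := by
    ext i j
    have := hB.apply i j
    simp [Matrix.one_apply, this, eq_comm]
  have hC : (lam • (1 : Matrix (Fin N) (Fin N) ℝ) - B).PosSemidef := by
    rw [hCH.posSemidef_iff_eigenvalues_nonneg]
    intro i
    have h1 := hCH.mulVec_eigenvectorBasis i
    have hne : (hCH.eigenvectorBasis i).ofLp ≠ 0 := by
      intro h
      have h2 := hCH.eigenvectorBasis.orthonormal.ne_zero i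
      exact h2 (by ext k; exact congrFun h k)
    rw [Matrix.sub_mulVec, Matrix.smul_mulVec, Matrix.one_mulVec] at h1
    have h3 : Module.End.HasEigenvalue (Matrix.toLin' B) (lam - hCH.eigenvalues i) := by
      refine Module.End.hasEigenvalue_of_hasEigenvector
        (x := (hCH.eigenvectorBasis i).ofLp) ⟨?_, hne⟩
      rw [Module.End.mem_eigenspace_iff, Matrix.toLin'_apply, sub_smul, ← h1]
      simp
    have h4 := (abs_le.1 (hspec _ h3)).2
    simp only [Pi.zero_apply]
    linarith
  have hJ : (β • (Matrix.of (fun _ _ => (1:ℝ)) : Matrix (Fin N) (Fin N) ℝ)).PosSemidef := by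
    have := (Matrix.posSemidef_vecMulVec_self_star (fun _ : Fin N => (1:ℝ))).smul hβ0
    convert this using 2
    ext i j
    simp [Matrix.vecMulVec_apply]
  have hI : (lam • (1 : Matrix (Fin N) (Fin N) ℝ)).PosDef := Matrix.PosDef.one.smul hlam
  subst hBm hBp
  refine ⟨fun i j => ?_, fun i j => ?_, hI.add_posSemidef hJ, ?_⟩
  · by_cases h : i = j <;> simp [Matrix.one_apply, h] <;> linarith
  · by_cases h : i = j
    · subst h
      have := hC.diag_nonneg (i := i)
      simp at this ⊢
      linarith
    · simpa [Matrix.one_apply, h] using hoff i j h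
  · convert hC.add hJ using 1
    abel
end

section
/- Let L > 0 and let K : ℝ → ℝ be nonnegative, even, nonincreasing on [0, ∞), and convex on [0, ∞), and assume that for every x the series K_L(x) := Σ_{n∈ℤ} K(x - nL) converges. Then the L-periodization K_L is bell-shaped on the torus of length L: K_L is even, L-periodic, and nonincreasing on [0, L/2]. -/
lemma conv_pair (K : ℝ → ℝ) (hK : ConvexOn ℝ (Set.Ici 0) K) (a b c d : ℝ) (ha : 0 ≤ a)
    (hac : a ≤ c) (hcb : c ≤ b) (h : c + d = a + b) : K c + K d ≤ K a + K b := by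
  rcases eq_or_lt_of_le (hac.trans hcb) with hab | hab
  · have h1 : c = a := by linarith
    have h2 : d = b := by linarith
    rw [h1, h2]
  · have hb : 0 ≤ b := by linarith
    have hp : 0 < b - a := by linarith
    have ht0 : 0 ≤ (b - c) / (b - a) := div_nonneg (by linarith) hp.le
    have hs0 : 0 ≤ (c - a) / (b - a) := div_nonneg (by linarith) hp.le
    have hts : (b - c) / (b - a) + (c - a) / (b - a) = 1 := by
      field_simp; ring
    have hc : (b - c) / (b - a) * a + (c - a) / (b - a) * b = c := by
      field_simp; ring
    generalize (b - c) / (b - a) = t at *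
    generalize (c - a) / (b - a) = s at *
    have h1 := hK.2 (Set.mem_Ici.2 ha) (Set.mem_Ici.2 hb) ht0 hs0 hts
    have h2 := hK.2 (Set.mem_Ici.2 hb) (Set.mem_Ici.2 ha) ht0 hs0 hts
    simp only [smul_eq_mul] at h1 h2
    have hd : t * b + s * a = d := by
      have : (t + s) * (a + b) = a + b := by rw [hts, one_mul]
      linarith
    rw [hc] at h1
    rw [hd] at h2
    have : (t + s) * (K a + K b) = K a + K b := by rw [hts, one_mul]
    linarith

/-- The `L`-periodization `K_L(x) = Σ_{n∈ℤ} K(x - nL)` of a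
nonnegative, even kernel `K` that is nonincreasing and convex on `[0,∞)` is
bell-shaped on the torus: even, `L`-periodic, and nonincreasing on `[0, L/2]`. -/
theorem periodization_bell_shaped
    (L : ℝ) (hL : 0 < L) (K : ℝ → ℝ)
    (hKnn : ∀ x, 0 ≤ K x)
    (hKeven : ∀ x, K (-x) = K x)
    (hKmono : AntitoneOn K (Set.Ici 0))
    (hKconv : ConvexOn ℝ (Set.Ici 0) K)
    (hsum : ∀ x : ℝ, Summable fun n : ℤ => K (x - n * L))
    (KL : ℝ → ℝ) (hKL : ∀ x, KL x = ∑' n : ℤ, K (x - n * L)) :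
    (∀ x, KL (-x) = KL x) ∧ (∀ x, KL (x + L) = KL x) ∧
    AntitoneOn KL (Set.Icc 0 (L/2)) := by
  have hper : ∀ x, KL (x - L) = KL x := by
    intro x
    rw [hKL, hKL, ← (Equiv.addRight (1 : ℤ)).tsum_eq (fun n : ℤ => K (x - n * L))]
    congr 1
    ext n
    simp only [Equiv.coe_addRight]
    push_cast
    congr 1
    ring
  have hev : ∀ x, KL (-x) = KL x := by
    intro x
    rw [hKL, hKL, ← (Equiv.neg ℤ).tsum_eq (fun n : ℤ => K (x - n * L))]
    congr 1
    ext n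
    simp only [Equiv.neg_apply]
    rw [← hKeven]
    push_cast
    congr 1
    ring
  refine ⟨hev, fun x => ?_, ?_⟩
  · rw [← hper (x + L)]
    congr 1
    ring
  · intro x hx y hy hxy
    obtain ⟨hx0, hx1⟩ := hx
    obtain ⟨hy0, hy1⟩ := hy
    have h2 : ∀ z, KL z + KL z = ∑' n : ℤ, (K (z - n * L) + K (L - z - n * L)) := by
      intro z
      rw [(hsum z).tsum_add (hsum (L - z)), ← hKL, ← hKL, ← hev (L - z), neg_sub, hper]
    have key : KL y + KL y ≤ KL x + KL x := by
      rw [h2, h2]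
      refine ((hsum y).add (hsum (L - y))).tsum_le_tsum (fun n => ?_)
        ((hsum x).add (hsum (L - x)))
      rcases le_or_gt n 0 with hn | hn
      · have hn' : (n : ℝ) ≤ 0 := by exact_mod_cast hn
        have hnL : (n : ℝ) * L ≤ 0 := mul_nonpos_of_nonpos_of_nonneg hn' hL.le
        exact conv_pair K hKconv _ _ _ _ (by linarith) (by linarith) (by linarith) (by ring)
      · have hn' : (1 : ℝ) ≤ n := by exact_mod_cast hn
        have hnL : L ≤ (n : ℝ) * L := by nlinarith
        rw [← hKeven (y - n * L), ← hKeven (x - n * L), ← hKeven (L - y - n * L),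
          ← hKeven (L - x - n * L), add_comm (K (-(y - n * L))), add_comm (K (-(x - n * L)))]
        exact conv_pair K hKconv _ _ _ _ (by linarith) (by linarith) (by linarith) (by ring)
    linarith
end

section
/- Let L > 0, and let g, u : ℝ → ℝ be L-periodic, integrable on [-L/2, L/2], and bell-shaped (even and nonincreasing on [0, L/2]), with u differentiable almost everywhere on [0, L/2]. Then the periodic convolution (g ⊛ u)(x) := ∫_{-L/2}^{L/2} g(y)·u(x - y) dy is also L-periodic and bell-shaped: it is even and nonincreasing on [0, L/2]. -/
open MeasureTheory

lemma bell_key (L : ℝ) (f : ℝ → ℝ)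
    (hper : ∀ x, f (x + L) = f x) (heven : ∀ x, f (-x) = f x)
    (hmono : AntitoneOn f (Set.Icc 0 (L/2))) (p q : ℝ)
    (hp : 0 ≤ p) (hp' : p ≤ L/2) (hq : 0 ≤ q) (hq' : q ≤ L/2) : f (p + q) ≤ f (p - q) := by
  have h1 : f (p - q) = f |p - q| := by
    rcases abs_choice (p - q) with h | h <;> rw [h]
    rw [heven]
  have hb : |p - q| ≤ L/2 := abs_le.2 ⟨by linarith, by linarith⟩
  rw [h1]
  rcases le_total (p + q) (L/2) with h | h
  · exact hmono ⟨abs_nonneg _, hb⟩ ⟨by linarith, h⟩ (abs_le.2 ⟨by linarith, by linarith⟩)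
  · have h2 : f (p + q) = f (L - p - q) := by
      rw [← heven, ← hper]; congr 1; ring
    rw [h2]
    exact hmono ⟨abs_nonneg _, hb⟩ ⟨by linarith, by linarith⟩
      (abs_le.2 ⟨by linarith, by linarith⟩)

lemma bell_bdd (L : ℝ) (hL : 0 < L) (f : ℝ → ℝ)
    (hper : ∀ x, f (x + L) = f x) (heven : ∀ x, f (-x) = f x)
    (hmono : AntitoneOn f (Set.Icc 0 (L/2))) (x : ℝ) : ‖f x‖ ≤ |f 0| + |f (L/2)| := by
  have hP : Function.Periodic f L := hper
  obtain ⟨y, hy, hxy⟩ := hP.exists_mem_Ico hL x (-(L/2))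
  have h1 : f y = f |y| := by
    rcases abs_choice y with h | h <;> rw [h]
    rw [heven]
  have hb : |y| ≤ L/2 := abs_le.2 ⟨hy.1, by linarith [hy.2]⟩
  have h2 := hmono ⟨le_rfl, by linarith⟩ ⟨abs_nonneg y, hb⟩ (abs_nonneg y)
  have h3 := hmono ⟨abs_nonneg y, hb⟩ ⟨by linarith, le_rfl⟩ hb
  rw [hxy, h1, Real.norm_eq_abs]
  apply abs_le.2
  constructor
  · linarith [neg_abs_le (f (L/2)), abs_nonneg (f 0)]
  · linarith [le_abs_self (f 0), abs_nonneg (f (L/2))]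

lemma bell_ii (L : ℝ) (hL : 0 < L) (f : ℝ → ℝ)
    (hper : ∀ x, f (x + L) = f x) (hint : IntegrableOn f (Set.Icc (-(L/2)) (L/2)))
    (a b : ℝ) : IntervalIntegrable f volume a b := by
  have hP : Function.Periodic f L := hper
  refine hP.intervalIntegrable hL.ne' (t := -(L/2)) ?_ a b
  rw [intervalIntegrable_iff_integrableOn_Icc_of_le (by linarith)]
  rwa [show -(L/2) + L = L/2 by ring]

/-- The periodic convolution of two `L`-periodic bell-shaped
(even and nonincreasing on `[0, L/2]`) integrable functions is again `L`-periodic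
and bell-shaped. -/
theorem periodic_convolution_bell_shaped
    (L : ℝ) (hL : 0 < L) (g u : ℝ → ℝ)
    (hgper : ∀ x, g (x + L) = g x) (huper : ∀ x, u (x + L) = u x)
    (hgint : IntegrableOn g (Set.Icc (-(L/2)) (L/2)))
    (huint : IntegrableOn u (Set.Icc (-(L/2)) (L/2)))
    (hgeven : ∀ x, g (-x) = g x) (hueven : ∀ x, u (-x) = u x)
    (hgmono : AntitoneOn g (Set.Icc 0 (L/2)))
    (humono : AntitoneOn u (Set.Icc 0 (L/2)))
    (hudiff : ∀ᵐ x ∂(volume.restrict (Set.Icc 0 (L/2))), DifferentiableAt ℝ u x)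
    (c : ℝ → ℝ)
    (hc : ∀ x, c x = ∫ y in (-(L/2))..(L/2), g y * u (x - y)) :
    (∀ x, c (x + L) = c x) ∧ (∀ x, c (-x) = c x) ∧
    AntitoneOn c (Set.Icc 0 (L/2)) := by
  have hgi := bell_ii L hL g hgper hgint
  have hui := bell_ii L hL u huper huint
  -- integrability of products
  have hii : ∀ s w : ℝ, IntervalIntegrable (fun t => g (s + t) * u (w + t)) volume
      (-(L/2)) (L/2) := by
    intro s w
    have h1 : IntervalIntegrable (fun t => g (s + t)) volume (-(L/2)) (L/2) := by
      have := (hgi (s + -(L/2)) (s + L/2)).comp_add_left s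
      simpa using this
    have h2 : IntervalIntegrable (fun t => u (w + t)) volume (-(L/2)) (L/2) := by
      have := (hui (w + -(L/2)) (w + L/2)).comp_add_left w
      simpa using this
    rw [intervalIntegrable_iff] at h1 h2 ⊢
    exact Integrable.bdd_mul h2 h1.aestronglyMeasurable
      (Filter.Eventually.of_forall fun t => bell_bdd L hL g hgper hgeven hgmono (s + t))
  have hu' : ∀ x y, u (x - y) = u (y - x) := fun x y => by rw [← hueven]; congr 1; ring
  have hF : ∀ x, Function.Periodic (fun y => g y * u (x - y)) L := by
    intro x y
    simp only
    rw [hgper, hu' x, hu' x, ← huper (y - x)]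
    congr 2; ring
  have hc1 : ∀ x a, c x = ∫ t in (-(L/2))..(L/2), g (a + t) * u (a - x + t) := by
    intro x a
    have h := intervalIntegral.integral_comp_add_left (a := -(L/2)) (b := L/2)
      (fun y => g y * u (x - y)) a
    have h2 := (hF x).intervalIntegral_add_eq (-(L/2)) (a + -(L/2))
    rw [show -(L/2) + L = L/2 by ring, show a + -(L/2) + L = a + L/2 by ring] at h2
    rw [hc, h2, ← h]
    congr 1; ext t
    rw [hu']; congr 2; ring
  have hc2 : ∀ x a, c x = ∫ t in (-(L/2))..(L/2), g (-a + t) * u (x - a + t) := by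
    intro x a
    have h := intervalIntegral.integral_comp_neg (a := -(L/2)) (b := L/2)
      (fun t => g (a + t) * u (a - x + t))
    rw [neg_neg] at h
    rw [hc1 x a, ← h]
    congr 1; ext t
    rw [← hgeven, ← hueven]; congr 2 <;> ring
  refine ⟨?_, ?_, ?_⟩
  · intro x
    rw [hc, hc]
    congr 1; ext y
    rw [← huper (x - y)]; congr 2; ring
  · intro x
    rw [hc1 (-x) 0, hc2 x 0]
    simp
  · intro x hx z hz hxz
    obtain ⟨a, ha⟩ : ∃ a, a = (x + z)/2 := ⟨_, rfl⟩
    have hkey : 0 ≤ c x + c x - c z - c z := by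
      rw [show c x + c x - c z - c z = (∫ t in (-(L/2))..(L/2), g (a + t) * u (a - x + t)) +
        (∫ t in (-(L/2))..(L/2), g (-a + t) * u (x - a + t)) -
        (∫ t in (-(L/2))..(L/2), g (a + t) * u (a - z + t)) -
        (∫ t in (-(L/2))..(L/2), g (-a + t) * u (z - a + t)) by
          rw [← hc1, ← hc1, ← hc2, ← hc2],
        ← intervalIntegral.integral_add (hii _ _) (hii _ _),
        ← intervalIntegral.integral_sub ((hii _ _).add (hii _ _)) (hii _ _),
        ← intervalIntegral.integral_sub (((hii _ _).add (hii _ _)).sub (hii _ _)) (hii _ _)]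
      apply intervalIntegral.integral_nonneg (by linarith)
      intro t ht
      obtain ⟨d, hd⟩ : ∃ d, d = (z - x)/2 := ⟨_, rfl⟩
      rw [show a - x = d by rw [ha, hd]; ring, show x - a = -d by rw [ha, hd]; ring,
        show a - z = -d by rw [ha, hd]; ring, show z - a = d by rw [ha, hd]; ring]
      have ha0 : 0 ≤ a := by linarith [hx.1, hz.1]
      have ha1 : a ≤ L/2 := by linarith [hx.2, hz.2]
      have hd0 : 0 ≤ d := by linarith
      have hd1 : d ≤ L/2 := by linarith [hx.1, hz.2]
      have e1 : g (-a + t) = g (a - t) := by rw [← hgeven]; congr 1; ring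
      have e2 : u (-d + t) = u (d - t) := by rw [← hueven]; congr 1; ring
      rw [e1, e2]
      rcases le_total 0 t with h | h
      · have k1 := bell_key L g hgper hgeven hgmono a t ha0 ha1 h ht.2
        have k2 := bell_key L u huper hueven humono d t hd0 hd1 h ht.2
        nlinarith [mul_nonneg (sub_nonneg.2 k1) (sub_nonneg.2 k2)]
      · have k1 := bell_key L g hgper hgeven hgmono a (-t) ha0 ha1 (by linarith)
          (by linarith [ht.1])
        have k2 := bell_key L u huper hueven humono d (-t) hd0 hd1 (by linarith)
          (by linarith [ht.1])
        rw [sub_neg_eq_add, ← sub_eq_add_neg] at k1 k2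
        nlinarith [mul_nonneg (sub_nonneg.2 k1) (sub_nonneg.2 k2)]
    linarith
end
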